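/- Define Q(a;b) := 6·(s(a;2b) + s(2a;b) − 2·s(a;b)) for coprime positive integers a, b with a + b odd, and Q(-a;b) := -Q(a;b). Then Q satisfies the reciprocity law Q(a;b) + Q(b;a) = (a² + b² + 1)/(4ab) whenever a, b are coprime positive integers with a + b odd. -/

import Mathlib

open Finset Real

/-- The classical Dedekind sum `s(a;b)` defined by the cotangent sum. -/
noncomputable def dedekindS (a : ℤ) (b : ℕ) : ℝ :=
  (1 / (4 * (b : ℝ))) * ∑ ν ∈ Finset.Ico 1 b,
    Real.cot (Real.pi * a * ν / b) * Real.cot (Real.pi * ν / b)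

/-- The rational part `Q(a;b)` of the elliptic classical Dedekind sum. -/
noncomputable def Qpart (a b : ℕ) : ℝ :=
  6 * (dedekindS a (2 * b) + dedekindS (2 * a) b - 2 * dedekindS a b)

lemma qcot_add_pi_int (x : ℝ) (n : ℤ) : Real.cot (x + n * π) = Real.cot x := by
  rw [Real.cot_eq_cos_div_sin, Real.cot_eq_cos_div_sin, Real.cos_add_int_mul_pi,
    Real.sin_add_int_mul_pi]
  have h : ((-1 : ℝ) ^ n) ≠ 0 := zpow_ne_zero _ (by norm_num)
  rw [mul_div_mul_left _ _ h]

lemma qcot_neg (x : ℝ) : Real.cot (-x) = -Real.cot x := by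
  rw [Real.cot_eq_cos_div_sin, Real.cot_eq_cos_div_sin, Real.cos_neg, Real.sin_neg, div_neg]

lemma qcot_zero : Real.cot 0 = 0 := by simp [Real.cot_eq_cos_div_sin]

lemma qcot_double (x : ℝ) : Real.cot x + Real.cot (x + π / 2) = 2 * Real.cot (2 * x) := by
  rw [Real.cot_eq_cos_div_sin, Real.cot_eq_cos_div_sin, Real.cot_eq_cos_div_sin,
    Real.cos_add_pi_div_two, Real.sin_add_pi_div_two, Real.cos_two_mul, Real.sin_two_mul]
  by_cases h1 : Real.sin x = 0
  · simp [h1]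
  by_cases h2 : Real.cos x = 0
  · simp [h2]
  field_simp
  linarith [Real.sin_sq_add_cos_sq x]

lemma qsin_ne (p : ℤ) (q : ℕ) (hq : 0 < q) (h : ¬ (q : ℤ) ∣ p) (x : ℝ) (hx : x * q = π * p) :
    Real.sin x ≠ 0 := by
  intro h0
  obtain ⟨n, hn⟩ := Real.sin_eq_zero_iff.1 h0
  apply h
  refine ⟨n, ?_⟩
  have : (p : ℝ) = q * n := by
    have hp := Real.pi_ne_zero
    apply mul_left_cancel₀ hp
    rw [← hx, ← hn]; ring
  exact_mod_cast this

lemma qcot_identity (x y : ℝ) (hx : Real.sin x ≠ 0) (hy : Real.sin y ≠ 0)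
    (hxy : Real.sin (x - y) ≠ 0) :
    Real.cot (x - y) * (Real.cot y - Real.cot x) = Real.cot x * Real.cot y + 1 := by
  simp only [Real.cot_eq_cos_div_sin]
  have e : Real.cos y / Real.sin y - Real.cos x / Real.sin x
      = Real.sin (x - y) / (Real.sin x * Real.sin y) := by
    rw [Real.sin_sub]; field_simp
  rw [e, div_mul_div_comm, mul_comm (Real.sin (x - y)), mul_div_mul_right _ _ hxy, Real.cos_sub]
  field_simp

/-- complex form of the sum over shifts -/
lemma qroots (n : ℕ) (z w : ℂ) (hz : IsPrimitiveRoot z n) (hw : w ^ n ≠ 1) :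
    ∑ k ∈ range n, 1 / (w * z ^ k - 1) = n / (w ^ n - 1) := by
  have hwn : w ^ n - 1 ≠ 0 := sub_ne_zero.2 hw
  have h1 : ∀ k ∈ range n, 1 / (w * z ^ k - 1)
      = (∑ m ∈ range n, w ^ m * (z ^ m) ^ k) / (w ^ n - 1) := by
    intro k _
    have hp : (w * z ^ k) ^ n = w ^ n := by
      rw [mul_pow, ← pow_mul, mul_comm k n, pow_mul, hz.pow_eq_one, one_pow, mul_one]
    have hne : w * z ^ k - 1 ≠ 0 := by
      intro h
      apply hw
      rw [← hp, sub_eq_zero.1 h, one_pow]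
    rw [div_eq_div_iff hne hwn, one_mul, ← hp, ← geom_sum_mul]
    congr 1
    refine sum_congr rfl fun m _ => ?_
    rw [mul_pow, ← pow_mul, ← pow_mul, mul_comm k m]
  rw [sum_congr rfl h1, ← sum_div, sum_comm]
  congr 1
  rw [sum_eq_single 0]
  · simp
  · intro m hm hm0
    rw [← mul_sum]
    have hne : z ^ m - 1 ≠ 0 := sub_ne_zero.2
      (hz.pow_ne_one_of_pos_of_lt hm0 (mem_range.1 hm))
    have : (∑ k ∈ range n, (z ^ m) ^ k) * (z ^ m - 1) = 0 := by
      rw [geom_sum_mul, ← pow_mul, mul_comm m n, pow_mul, hz.pow_eq_one, one_pow, sub_self]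
    rw [(mul_eq_zero.1 this).resolve_right hne, mul_zero]
  · intro h
    have : n = 0 := by simpa using h
    simp [this]

lemma qcot_exp (x : ℝ) (hx : Real.sin x ≠ 0) :
    ((Real.cot x : ℝ) : ℂ) = Complex.I * (1 + 2 * (1 / (Complex.exp (2 * Complex.I * x) - 1))) ∧
      Complex.exp (2 * Complex.I * x) ≠ 1 := by
  have hs : Complex.sin x ≠ 0 := by
    rw [← Complex.ofReal_sin]; exact_mod_cast hx
  have e : Complex.exp (2 * Complex.I * x) - 1
      = 2 * Complex.I * Complex.sin x * Complex.exp (Complex.I * x) := by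
    have : Complex.exp (2 * Complex.I * x) = Complex.exp (Complex.I * x) ^ 2 := by
      rw [← Complex.exp_nat_mul]; congr 1; push_cast; ring
    rw [this, mul_comm Complex.I, Complex.exp_mul_I]
    linear_combination Complex.sin_sq_add_cos_sq x - (Complex.sin x)^2 * Complex.I_sq
  have he := Complex.exp_ne_zero (Complex.I * x)
  constructor
  · rw [e, Real.cot_eq_cos_div_sin]
    push_cast
    have h2 : (1:ℂ) / Complex.exp (Complex.I * x) = Complex.cos x - Complex.sin x * Complex.I := by
      rw [one_div, ← Complex.exp_neg, show -(Complex.I * x) = (-x : ℂ) * Complex.I by ring,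
        Complex.exp_mul_I, Complex.cos_neg, Complex.sin_neg]; ring
    have h3 : (1:ℂ) / (2 * Complex.I * Complex.sin x * Complex.exp (Complex.I * x))
        = (1 / (2 * Complex.I * Complex.sin x)) * (Complex.cos x - Complex.sin x * Complex.I) := by
      rw [← h2, div_mul_div_comm, one_mul]
    rw [h3]
    have := Complex.I_ne_zero
    field_simp
    ring
  · intro h
    rw [h, sub_self] at e
    have := Complex.I_ne_zero
    simp_all

lemma qcot_shift (n : ℕ) (hn : 0 < n) (x : ℝ) (hx : Real.sin (n * x) ≠ 0) :
    ∑ k ∈ range n, Real.cot (x + π * k / n) = n * Real.cot (n * x) := by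
  have hn' : (n : ℝ) ≠ 0 := by positivity
  have hnc : (n : ℂ) ≠ 0 := by exact_mod_cast hn.ne'
  have hk : ∀ k : ℕ, Real.sin (x + π * k / n) ≠ 0 := by
    intro k h
    obtain ⟨m, hm⟩ := Real.sin_eq_zero_iff.1 h
    apply hx
    rw [Real.sin_eq_zero_iff]
    refine ⟨n * m - k, ?_⟩
    have : x = m * π - π * k / n := by rw [hm]; ring
    rw [this]; push_cast; field_simp
  have hz := Complex.isPrimitiveRoot_exp n hn.ne'
  obtain ⟨e1, e2⟩ := qcot_exp _ hx
  have hw : Complex.exp (2 * Complex.I * x) ^ n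
      = Complex.exp (2 * Complex.I * ((n * x : ℝ) : ℂ)) := by
    rw [← Complex.exp_nat_mul]; congr 1; push_cast; ring
  have hr := qroots n _ (Complex.exp (2 * Complex.I * x)) hz (by rw [hw]; exact e2)
  rw [hw] at hr
  have : ((∑ k ∈ range n, Real.cot (x + π * k / n) : ℝ) : ℂ) = ((n * Real.cot (n * x) : ℝ) : ℂ) := by
    rw [Complex.ofReal_sum, Complex.ofReal_mul, e1]
    have : ∀ k ∈ range n, ((Real.cot (x + π * k / n) : ℝ) : ℂ)
        = Complex.I + 2 * Complex.I * (1 / (Complex.exp (2 * Complex.I * x) *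
          Complex.exp (2 * π * Complex.I / n) ^ k - 1)) := by
      intro k _
      rw [(qcot_exp _ (hk k)).1]
      have : Complex.exp (2 * Complex.I * ((x + π * k / n : ℝ) : ℂ))
          = Complex.exp (2 * Complex.I * x) * Complex.exp (2 * π * Complex.I / n) ^ k := by
        rw [← Complex.exp_nat_mul, ← Complex.exp_add]; congr 1; push_cast; field_simp
      rw [this]; ring
    rw [sum_congr rfl this, sum_add_distrib, ← mul_sum, hr]
    simp only [sum_const, card_range, nsmul_eq_mul, Complex.ofReal_natCast]
    ring
  exact_mod_cast this

lemma qrange_Ico (n : ℕ) (hn : 0 < n) (f : ℕ → ℝ) :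
    ∑ k ∈ range n, f k = f 0 + ∑ k ∈ Ico 1 n, f k := by
  rw [range_eq_Ico, sum_eq_sum_Ico_succ_bot hn]

lemma qcot_sum_zero (n : ℕ) (hn : 0 < n) : ∑ k ∈ Ico 1 n, Real.cot (π * k / n) = 0 := by
  have hn' : (n : ℝ) ≠ 0 := by positivity
  have h := sum_Ico_reflect (fun k : ℕ => Real.cot (π * k / n)) 1 (show n ≤ n + 1 by omega)
  have h2 : ∑ k ∈ Ico 1 n, Real.cot (π * ((n - k : ℕ) : ℝ) / n)
      = ∑ k ∈ Ico 1 n, -Real.cot (π * k / n) := by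
    refine sum_congr rfl fun k hk => ?_
    have hk' := mem_Ico.1 hk
    rw [Nat.cast_sub hk'.2.le, ← qcot_neg, ← qcot_add_pi_int (-(π * k / n)) 1]
    congr 1; push_cast; field_simp; ring
  simp only [Nat.add_sub_cancel_left, Nat.add_sub_cancel] at h
  rw [h2, sum_neg_distrib] at h
  linarith

lemma qcot_shift_zero (n : ℕ) (hn : 0 < n) (m : ℕ) :
    ∑ j ∈ range n, Real.cot (π * j / n - π * m / n) = 0 := by
  have hn' : (n : ℝ) ≠ 0 := by positivity
  induction m with
  | zero =>
    simp only [Nat.cast_zero, mul_zero, zero_div, sub_zero]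
    rw [qrange_Ico n hn (fun k => Real.cot (π * k / n)), qcot_sum_zero n hn]
    simp [qcot_zero]
  | succ m ih =>
    have h1 := sum_range_succ (fun j : ℕ => Real.cot (π * j / n - π * (m + 1 : ℕ) / n)) n
    have h2 := sum_range_succ' (fun j : ℕ => Real.cot (π * j / n - π * (m + 1 : ℕ) / n)) n
    have h3 : ∀ j ∈ range n, Real.cot (π * (j + 1 : ℕ) / n - π * (m + 1 : ℕ) / n)
        = Real.cot (π * j / n - π * m / n) := by
      intro j _; congr 1; push_cast; ring
    rw [sum_congr rfl h3, ih] at h2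
    have h4 : Real.cot (π * n / n - π * (m + 1 : ℕ) / n)
        = Real.cot (π * (0 : ℕ) / n - π * (m + 1 : ℕ) / n) := by
      rw [← qcot_add_pi_int (π * (0 : ℕ) / n - π * (m + 1 : ℕ) / n) 1]
      congr 1; push_cast; field_simp; ring
    linarith

lemma qnot_dvd (j n : ℕ) (hj : j ∈ Ico 1 n) : ¬ n ∣ j := by
  have := mem_Ico.1 hj
  exact Nat.not_dvd_of_pos_of_lt (by omega) (by omega)

lemma qcot_sq (n : ℕ) (hn : 0 < n) :
    ∑ k ∈ Ico 1 n, Real.cot (π * k / n) ^ 2 = ((n : ℝ) - 1) * (n - 2) / 3 := by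
  have hn' : (n : ℝ) ≠ 0 := by positivity
  set c : ℕ → ℝ := fun k => Real.cot (π * k / n) with hc
  set d : ℕ → ℕ → ℝ := fun j k => Real.cot (π * j / n - π * k / n) with hd
  have hs : ∀ j ∈ Ico 1 n, Real.sin (π * j / n) ≠ 0 := by
    intro j hj
    refine qsin_ne j n hn ?_ _ (by push_cast; field_simp)
    exact_mod_cast qnot_dvd j n hj
  have key : ∀ j ∈ Ico 1 n, ∀ k ∈ Ico 1 n,
      d j k * c k - d j k * c j = c j * c k + 1 - if j = k then (c j ^ 2 + 1) else 0 := by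
    intro j hj k hk
    by_cases h : j = k
    · subst h; simp [hd, qcot_zero]; ring
    · rw [if_neg h]
      have := qcot_identity (π * j / n) (π * k / n) (hs j hj) (hs k hk) (by
        refine qsin_ne (j - k) n hn ?_ _ (by push_cast; field_simp)
        intro hdv
        have h1 := mem_Ico.1 hj
        have h2 := mem_Ico.1 hk
        have := Int.eq_zero_of_abs_lt_dvd hdv (by rw [abs_lt]; constructor <;> omega)
        omega)
      simp only [hd, hc]; linarith
  have hcol : ∀ k, ∑ j ∈ Ico 1 n, d j k = c k := by
    intro k
    have := qcot_shift_zero n hn k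
    rw [qrange_Ico n hn (fun j => Real.cot (π * j / n - π * k / n))] at this
    have h0 : Real.cot (π * (0:ℕ) / n - π * k / n) = - c k := by
      rw [← qcot_neg]; congr 1; push_cast; ring
    simp only [hd]; linarith
  have hanti : ∀ j k, d j k = - d k j := by
    intro j k; simp only [hd]; rw [← qcot_neg]; congr 1; ring
  have hrow : ∀ j, ∑ k ∈ Ico 1 n, d j k = - c j := by
    intro j; rw [← hcol j, ← sum_neg_distrib]; exact sum_congr rfl fun k _ => hanti j k
  have hsum := sum_congr rfl fun j hj => sum_congr rfl (key j hj)
  simp only [sum_sub_distrib, sum_add_distrib] at hsum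
  have A : ∑ j ∈ Ico 1 n, ∑ k ∈ Ico 1 n, d j k * c k = ∑ k ∈ Ico 1 n, c k ^ 2 := by
    rw [sum_comm]; refine sum_congr rfl fun k _ => ?_
    rw [← sum_mul, hcol]; ring
  have B : ∑ j ∈ Ico 1 n, ∑ k ∈ Ico 1 n, d j k * c j = - ∑ k ∈ Ico 1 n, c k ^ 2 := by
    rw [← sum_neg_distrib]; refine sum_congr rfl fun k _ => ?_
    rw [← sum_mul, hrow]; ring
  have C : ∑ j ∈ Ico 1 n, ∑ k ∈ Ico 1 n, c j * c k = 0 := by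
    rw [← sum_mul_sum, qcot_sum_zero n hn, zero_mul]
  have D : ∑ j ∈ Ico 1 n, ∑ k ∈ Ico 1 n, (if j = k then (c j ^ 2 + 1) else 0)
      = ∑ k ∈ Ico 1 n, c k ^ 2 + (n - 1) := by
    have : ∀ j ∈ Ico 1 n, ∑ k ∈ Ico 1 n, (if j = k then (c j ^ 2 + 1) else 0) = c j ^ 2 + 1 := by
      intro j hj; rw [sum_ite_eq, if_pos hj]
    rw [sum_congr rfl this, sum_add_distrib]
    simp [Nat.cast_sub (show 1 ≤ n from hn)]
  rw [A, B, C, D] at hsum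
  simp only [sum_const, Nat.card_Ico, nsmul_eq_mul, Nat.cast_sub (show 1 ≤ n from hn)] at hsum
  push_cast at hsum
  linarith

lemma qsum_ded (a b : ℕ) (hb : 0 < b) :
    ∑ k ∈ Ico 1 b, Real.cot (a * (π * k / b)) * Real.cot (π * k / b)
      = 4 * b * dedekindS a b := by
  have hb' : (b : ℝ) ≠ 0 := by positivity
  rw [dedekindS, ← mul_assoc, mul_one_div_cancel (by positivity), one_mul]
  refine sum_congr rfl fun k _ => ?_
  congr 2; push_cast; ring

lemma qshift_col (a b k : ℕ) (ha : 0 < a) (hb : 0 < b) (hcop : Nat.Coprime a b)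
    (hk : k ∈ Ico 1 b) :
    ∑ j ∈ Ico 1 a, Real.cot (π * j / a - π * k / b)
      = - a * Real.cot (a * (π * k / b)) + Real.cot (π * k / b) := by
  have hb' : (b : ℝ) ≠ 0 := by positivity
  have h := qcot_shift a ha (-(π * k / b)) (by
    rw [mul_neg, Real.sin_neg, neg_ne_zero]
    refine qsin_ne (a * k) b hb ?_ _ (by push_cast; field_simp)
    intro hd
    have hd' : b ∣ a * k := by exact_mod_cast hd
    exact qnot_dvd k b hk (hcop.symm.dvd_of_dvd_mul_left hd'))
  rw [qrange_Ico a ha (fun j => Real.cot (-(π * k / b) + π * j / a)), mul_neg, qcot_neg] at h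
  simp only [Nat.cast_zero, mul_zero, zero_div, add_zero, qcot_neg] at h
  have : ∑ j ∈ Ico 1 a, Real.cot (π * j / a - π * k / b)
      = ∑ j ∈ Ico 1 a, Real.cot (-(π * k / b) + π * j / a) :=
    sum_congr rfl fun j _ => by congr 1; ring
  rw [this]; linarith

lemma qreciprocity (a b : ℕ) (ha : 0 < a) (hb : 0 < b) (hcop : Nat.Coprime a b) :
    dedekindS a b + dedekindS b a
      = -1 / 4 + ((a : ℝ) / b + b / a + 1 / (a * b)) / 12 := by
  have ha' : (a : ℝ) ≠ 0 := by positivity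
  have hb' : (b : ℝ) ≠ 0 := by positivity
  have hs : ∀ n : ℕ, 0 < n → ∀ j ∈ Ico 1 n, Real.sin (π * j / n) ≠ 0 := by
    intro n hn j hj
    have hn' : (n : ℝ) ≠ 0 := by positivity
    refine qsin_ne j n hn ?_ _ (by push_cast; field_simp)
    exact_mod_cast qnot_dvd j n hj
  have key : ∀ j ∈ Ico 1 a, ∀ k ∈ Ico 1 b,
      Real.cot (π * j / a - π * k / b) * Real.cot (π * k / b)
        + Real.cot (π * k / b - π * j / a) * Real.cot (π * j / a)
      = Real.cot (π * j / a) * Real.cot (π * k / b) + 1 := by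
    intro j hj k hk
    rw [← qcot_identity (π * j / a) (π * k / b) (hs a ha j hj) (hs b hb k hk) (by
      refine qsin_ne (j * b - k * a) (a * b) (by positivity) ?_ _ (by push_cast; field_simp)
      intro hd
      have h1 : (a : ℤ) ∣ j * b - k * a := dvd_trans ⟨b, by push_cast; ring⟩ hd
      have h2 : (a : ℤ) ∣ j * b := by
        have := dvd_add h1 (Dvd.intro_left (k : ℤ) rfl)
        rwa [sub_add_cancel] at this
      have h3 : a ∣ j * b := by exact_mod_cast h2
      exact qnot_dvd j a hj (hcop.dvd_of_dvd_mul_right h3))]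
    rw [show π * k / b - π * j / a = -(π * j / a - π * k / b) by ring, qcot_neg]
    ring
  have hsum := sum_congr rfl fun j hj => sum_congr rfl (key j hj)
  simp only [sum_add_distrib] at hsum
  rw [← sum_mul_sum, qcot_sum_zero a ha, zero_mul] at hsum
  have A : ∀ a b : ℕ, 0 < a → 0 < b → Nat.Coprime a b → ∑ k ∈ Ico 1 b, ∑ j ∈ Ico 1 a,
      Real.cot (π * j / a - π * k / b) * Real.cot (π * k / b)
      = - a * (4 * b * dedekindS a b) + ((b : ℝ) - 1) * (b - 2) / 3 := by
    intro a b ha hb hcop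
    rw [← qsum_ded a b hb, ← qcot_sq b hb, mul_sum, ← sum_add_distrib]
    refine sum_congr rfl fun k hk => ?_
    rw [← sum_mul, qshift_col a b k ha hb hcop hk]
    ring
  rw [A b a hb ha hcop.symm, sum_comm, A a b ha hb hcop] at hsum
  simp only [sum_const, Nat.card_Ico, nsmul_eq_mul, Nat.cast_sub (show 1 ≤ a from ha),
    Nat.cast_sub (show 1 ≤ b from hb)] at hsum
  push_cast at hsum
  field_simp
  linarith

lemma qded_double (a b : ℕ) (hb : 0 < b) :
    dedekindS (2 * a) (2 * b) = dedekindS a b := by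
  have hb' : (b : ℝ) ≠ 0 := by positivity
  have h1 := qrange_Ico (2 * b) (by omega) (fun ν => Real.cot (π * ((2 * a : ℤ) : ℝ) * ν / ((2 * b : ℕ) : ℝ)) *
    Real.cot (π * ν / ((2 * b : ℕ) : ℝ)))
  have h2 := qrange_Ico b hb (fun ν => Real.cot (π * ((a : ℤ) : ℝ) * ν / b) *
    Real.cot (π * ν / b))
  simp only [Nat.cast_zero, mul_zero, zero_div, qcot_zero, zero_add] at h1 h2
  rw [dedekindS, dedekindS, ← h1, ← h2, two_mul b, sum_range_add, ← sum_add_distrib, mul_sum, mul_sum]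
  refine sum_congr rfl fun ν _ => ?_
  have e1 : Real.cot (π * ((2 * a : ℤ) : ℝ) * ν / ((b + b : ℕ) : ℝ))
      = Real.cot (π * ((a : ℤ) : ℝ) * ν / b) := by
    congr 1; push_cast; field_simp; ring
  have e2 : Real.cot (π * ((2 * a : ℤ) : ℝ) * ((b + ν : ℕ) : ℝ) / ((b + b : ℕ) : ℝ))
      = Real.cot (π * ((a : ℤ) : ℝ) * ν / b) := by
    rw [← qcot_add_pi_int (π * ((a : ℤ) : ℝ) * ν / b) a]
    congr 1; push_cast; field_simp; ring
  have e3 := qcot_double (π * ν / ((b + b : ℕ) : ℝ))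
  have e4 : π * ν / ((b + b : ℕ) : ℝ) + π / 2 = π * ((b + ν : ℕ) : ℝ) / ((b + b : ℕ) : ℝ) := by
    push_cast; field_simp; ring
  have e5 : 2 * (π * ν / ((b + b : ℕ) : ℝ)) = π * ν / b := by
    push_cast; field_simp; ring
  rw [e4, e5] at e3
  rw [e1, e2, ← mul_add, e3]
  push_cast; field_simp; ring

lemma qmain (c b : ℕ) (hc : 0 < c) (hb : 0 < b) (hcop : Nat.Coprime (2 * c) b) :
    Qpart (2 * c) b + Qpart b (2 * c)
      = (((2 * c : ℕ) : ℝ) ^ 2 + (b : ℝ) ^ 2 + 1) / (4 * ((2 * c : ℕ) : ℝ) * b) := by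
  have hc' : (c : ℝ) ≠ 0 := by positivity
  have hb' : (b : ℝ) ≠ 0 := by positivity
  have h2 : Nat.Coprime 2 b := Nat.Coprime.coprime_mul_right hcop
  have h1 : Nat.Coprime c b := Nat.Coprime.coprime_mul_left hcop
  have r1 := qreciprocity c b hc hb h1
  have r2 := qreciprocity (2 * c) b (by omega) hb hcop
  have r3 := qreciprocity (2 * (2 * c)) b (by omega) hb (Nat.Coprime.mul_left h2 hcop)
  have d1 := qded_double c b hb
  have d2 := qded_double b c hc
  unfold Qpart
  push_cast at *
  rw [d1, d2]
  have : ((2 * c : ℝ) ^ 2 + (b : ℝ) ^ 2 + 1) / (4 * (2 * c) * b) =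
    6 * ((-1 / 4 + ((c : ℝ) / b + b / c + 1 / (c * b)) / 12)
      + (-1 / 4 + ((2 * (2 * c) : ℝ) / b + b / (2 * (2 * c)) + 1 / (2 * (2 * c) * b)) / 12)
      - 2 * (-1 / 4 + ((2 * c : ℝ) / b + b / (2 * c) + 1 / (2 * c * b)) / 12)) := by
    field_simp; ring
  rw [this, ← r1, ← r2, ← r3]
  ring

theorem Qpart_reciprocity (a b : ℕ) (ha : 0 < a) (hb : 0 < b) (hcop : Nat.gcd a b = 1)
    (hodd : Odd (a + b)) :
    Qpart a b + Qpart b a = ((a : ℝ) ^ 2 + (b : ℝ) ^ 2 + 1) / (4 * a * b) := by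
  rcases Nat.even_or_odd' a with ⟨c, rfl | rfl⟩
  · exact qmain c b (by omega) hb hcop
  · rcases Nat.even_or_odd' b with ⟨d, rfl | rfl⟩
    · have := qmain d (2 * c + 1) (by omega) ha (Nat.Coprime.symm hcop)
      rw [add_comm, this]
      congr 1 <;> ring
    · exfalso
      obtain ⟨m, hm⟩ := hodd
      omega
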